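/- arXiv:1310.3549 — 4 statements merged into one kernel-verified Lean document; each statement's English description precedes it below -/
import Mathlib

section
/- For every matrix A in the special orthogonal group SO(3) of 3×3 real matrices, there exists a unit quaternion q such that for all real b, c, d, we have q·(b·i + c·j + d·k)·q⁻¹ = b'·i + c'·j + d'·k, where (b', c', d') is the image of (b, c, d) under A. That is, the homomorphism from the unit quaternions to SO(3) induced by conjugation (written in the basis i, j, k of the pure imaginary quaternions) is surjective. -/
open Quaternion

/-- Quaternion from its components. -/
def mkq (w x y z : ℝ) : ℍ[ℝ] := ⟨w, x, y, z⟩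

/-- Normalizing a nonzero intertwiner. -/
theorem aux_normalize (f : ℝ → ℝ → ℝ → ℍ[ℝ]) (q : ℍ[ℝ]) (hq : q ≠ 0)
    (h : ∀ b c d : ℝ, q * mkq 0 b c d = f b c d * q) :
    ∃ q : ℍ[ℝ], ‖q‖ = 1 ∧ ∀ b c d : ℝ, q * mkq 0 b c d * q⁻¹ = f b c d := by
  have hn : ‖q‖ ≠ 0 := norm_ne_zero_iff.mpr hq
  have hq' : (‖q‖⁻¹ • q) ≠ 0 := smul_ne_zero (inv_ne_zero hn) hq
  refine ⟨‖q‖⁻¹ • q, ?_, fun b c d => ?_⟩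
  · rw [norm_smul, norm_inv, norm_norm, inv_mul_cancel₀ hn]
  · rw [mul_inv_eq_iff_eq_mul₀ hq', smul_mul_assoc, h, mul_smul_comm]

theorem aux_intertwine (A : Matrix (Fin 3) (Fin 3) ℝ) (w x y z : ℝ)
    (h : ∀ b c d : ℝ, (mkq w x y z) * mkq 0 b c d =
      mkq 0 (A 0 0 * b + A 0 1 * c + A 0 2 * d) (A 1 0 * b + A 1 1 * c + A 1 2 * d)
        (A 2 0 * b + A 2 1 * c + A 2 2 * d) * mkq w x y z)
    (hq : w ≠ 0 ∨ x ≠ 0 ∨ y ≠ 0 ∨ z ≠ 0) :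
    ∃ q : ℍ[ℝ], ‖q‖ = 1 ∧ ∀ b c d : ℝ,
      q * mkq 0 b c d * q⁻¹ =
      mkq 0 (A 0 0 * b + A 0 1 * c + A 0 2 * d) (A 1 0 * b + A 1 1 * c + A 1 2 * d)
        (A 2 0 * b + A 2 1 * c + A 2 2 * d) := by
  refine aux_normalize _ (mkq w x y z) ?_ h
  intro h0
  have h1 := congrArg QuaternionAlgebra.re h0
  have h2 := congrArg QuaternionAlgebra.imI h0
  have h3 := congrArg QuaternionAlgebra.imJ h0
  have h4 := congrArg QuaternionAlgebra.imK h0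
  simp [mkq] at h1 h2 h3 h4
  tauto

theorem aux_mul (a00 a01 a02 a10 a11 a12 a20 a21 a22 w x y z : ℝ)
    (e1 : -x = -(a00 * x + a10 * y + a20 * z))
    (e2 : w = a00 * w + a10 * z - a20 * y)
    (e3 : z = -(a00 * z) + a10 * w + a20 * x)
    (e4 : -y = a00 * y - a10 * x + a20 * w)
    (f1 : -y = -(a01 * x + a11 * y + a21 * z))
    (f2 : -z = a01 * w + a11 * z - a21 * y)
    (f3 : w = -(a01 * z) + a11 * w + a21 * x)
    (f4 : x = a01 * y - a11 * x + a21 * w)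
    (g1 : -z = -(a02 * x + a12 * y + a22 * z))
    (g2 : y = a02 * w + a12 * z - a22 * y)
    (g3 : -x = -(a02 * z) + a12 * w + a22 * x)
    (g4 : w = a02 * y - a12 * x + a22 * w) (b c d : ℝ) :
    (mkq w x y z) * mkq 0 b c d =
      mkq 0 (a00 * b + a01 * c + a02 * d) (a10 * b + a11 * c + a12 * d)
        (a20 * b + a21 * c + a22 * d) * mkq w x y z := by
  ext
  · simp only [Quaternion.re_mul]
    simp only [mkq]
    linear_combination b * e1 + c * f1 + d * g1
  · simp only [Quaternion.imI_mul]
    simp only [mkq]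
    linear_combination b * e2 + c * f2 + d * g2
  · simp only [Quaternion.imJ_mul]
    simp only [mkq]
    linear_combination b * e3 + c * f3 + d * g3
  · simp only [Quaternion.imK_mul]
    simp only [mkq]
    linear_combination b * e4 + c * f4 + d * g4

theorem conj_to_SO3_surjective (A : Matrix (Fin 3) (Fin 3) ℝ)
    (hA : A ∈ Matrix.specialOrthogonalGroup (Fin 3) ℝ) :
    ∃ q : ℍ[ℝ], ‖q‖ = 1 ∧ ∀ b c d : ℝ,
      q * (show ℍ[ℝ] from ⟨0, b, c, d⟩) * q⁻¹ =
        (show ℍ[ℝ] from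
          ⟨0, A.mulVec ![b, c, d] 0, A.mulVec ![b, c, d] 1, A.mulVec ![b, c, d] 2⟩) := by
  rw [Matrix.mem_specialOrthogonalGroup_iff] at hA
  obtain ⟨hO, hdet⟩ := hA
  have h1 : A * A.transpose = 1 := (Matrix.mem_orthogonalGroup_iff (Fin 3) ℝ).mp hO
  have h2 : A.transpose * A = 1 := (Matrix.mem_orthogonalGroup_iff' (Fin 3) ℝ).mp hO
  have h3 : A.adjugate = A.transpose := by
    have := A.mul_adjugate
    rw [hdet, one_smul] at this
    calc A.adjugate = A.transpose * A * A.adjugate := by rw [h2, one_mul]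
      _ = A.transpose := by rw [mul_assoc, this, mul_one]
  have p := fun i j => congrFun (congrFun h1 i) j
  have r := fun i j => congrFun (congrFun h2 i) j
  have s := fun i j => congrFun (congrFun h3 i) j
  rw [Matrix.adjugate_fin_three] at s
  have p00 := p 0 0
  have p01 := p 0 1
  have p02 := p 0 2
  have p11 := p 1 1
  have p12 := p 1 2
  have p22 := p 2 2
  have r00 := r 0 0
  have r01 := r 0 1
  have r02 := r 0 2
  have r11 := r 1 1
  have r12 := r 1 2
  have r22 := r 2 2
  have s00 := s 0 0
  have s01 := s 0 1
  have s02 := s 0 2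
  have s10 := s 1 0
  have s11 := s 1 1
  have s12 := s 1 2
  have s20 := s 2 0
  have s21 := s 2 1
  have s22 := s 2 2
  clear p r s h1 h2 h3 hO hdet
  simp [Matrix.mul_apply, Fin.sum_univ_three] at p00 p01 p02 p11 p12 p22 r00 r01 r02 r11 r12 r22 s00 s01 s02 s10 s11 s12 s20 s21 s22
  simp only [Matrix.mulVec, dotProduct, Fin.sum_univ_three, Matrix.cons_val]
  change ∃ q : ℍ[ℝ], ‖q‖ = 1 ∧ ∀ b c d : ℝ, q * mkq 0 b c d * q⁻¹ =
    mkq 0 (A 0 0 * b + A 0 1 * c + A 0 2 * d) (A 1 0 * b + A 1 1 * c + A 1 2 * d)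
      (A 2 0 * b + A 2 1 * c + A 2 2 * d)
  by_cases hw : 1 + A 0 0 + A 1 1 + A 2 2 = 0
  · by_cases hx : 1 + A 0 0 - A 1 1 - A 2 2 = 0
    · by_cases hy : 1 - A 0 0 + A 1 1 - A 2 2 = 0
      · have hz : 1 - A 0 0 - A 1 1 + A 2 2 ≠ 0 := by
          intro hz
          linarith
        refine aux_intertwine A (A 1 0 - A 0 1) (A 0 2 + A 2 0) (A 1 2 + A 2 1)
          (1 - A 0 0 - A 1 1 + A 2 2) (aux_mul _ _ _ _ _ _ _ _ _ _ _ _ _ ?_ ?_ ?_ ?_ ?_ ?_ ?_ ?_ ?_ ?_ ?_ ?_)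
          (Or.inr (Or.inr (Or.inr hz)))
        all_goals clear hw hx hy hz; linarith
      · refine aux_intertwine A (A 0 2 - A 2 0) (A 0 1 + A 1 0) (1 - A 0 0 + A 1 1 - A 2 2)
          (A 1 2 + A 2 1) (aux_mul _ _ _ _ _ _ _ _ _ _ _ _ _ ?_ ?_ ?_ ?_ ?_ ?_ ?_ ?_ ?_ ?_ ?_ ?_)
          (Or.inr (Or.inr (Or.inl hy)))
        all_goals clear hw hx hy; linarith
    · refine aux_intertwine A (A 2 1 - A 1 2) (1 + A 0 0 - A 1 1 - A 2 2) (A 0 1 + A 1 0)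
        (A 0 2 + A 2 0) (aux_mul _ _ _ _ _ _ _ _ _ _ _ _ _ ?_ ?_ ?_ ?_ ?_ ?_ ?_ ?_ ?_ ?_ ?_ ?_)
        (Or.inr (Or.inl hx))
      all_goals clear hw hx; linarith
  · refine aux_intertwine A (1 + A 0 0 + A 1 1 + A 2 2) (A 2 1 - A 1 2) (A 0 2 - A 2 0)
      (A 1 0 - A 0 1) (aux_mul _ _ _ _ _ _ _ _ _ _ _ _ _ ?_ ?_ ?_ ?_ ?_ ?_ ?_ ?_ ?_ ?_ ?_ ?_)
      (Or.inl hw)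
    all_goals clear hw; linarith
end

section
/- Let x = (cot(π/5) + cot(2π/5))/2 and y = (cot(π/5) − cot(2π/5))/2, and set f = x·i + y·j and f' = x·j + y·k as pure imaginary quaternions. Let q = cos(π/5) + sin(π/5)•f and q' = cos(π/5) + sin(π/5)•f'. Then the real part of q⁻¹·q' equals cos(π/5); equivalently, q and q' are at spherical distance π/5 from each other (as well as from 1). -/
open Quaternion Real RealInnerProductSpace

/-- With `x = (cot(π/5) + cot(2π/5))/2`, `y = (cot(π/5) − cot(2π/5))/2`,
`f = x·i + y·j`, `f' = x·j + y·k`, `q = cos(π/5) + sin(π/5)•f`, and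
`q' = cos(π/5) + sin(π/5)•f'`, the real part of `q⁻¹ · q'` equals `cos(π/5)`;
equivalently `q` and `q'` are at spherical distance `π/5` from each other. -/
theorem adjacent_face_rotations_distance
    (x y : ℝ) (hx : x = (Real.cot (π / 5) + Real.cot (2 * π / 5)) / 2)
    (hy : y = (Real.cot (π / 5) - Real.cot (2 * π / 5)) / 2)
    (f f' q q' : ℍ[ℝ])
    (hf : f = (show ℍ[ℝ] from ⟨0, x, y, 0⟩))
    (hf' : f' = (show ℍ[ℝ] from ⟨0, 0, x, y⟩))
    (hq : q = (Real.cos (π / 5) : ℍ[ℝ]) + Real.sin (π / 5) • f)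
    (hq' : q' = (Real.cos (π / 5) : ℍ[ℝ]) + Real.sin (π / 5) • f') :
    (q⁻¹ * q').re = Real.cos (π / 5) ∧ Real.arccos ⟪q, q'⟫ = π / 5 := by
  have hc5 := Real.cos_pi_div_five
  have h5 : √(5:ℝ) ^ 2 = 5 := Real.sq_sqrt (by norm_num)
  have h50 := Real.sqrt_nonneg (5:ℝ)
  have hs0 : 0 < Real.sin (π / 5) :=
    Real.sin_pos_of_pos_of_lt_pi (by positivity) (by linarith [Real.pi_pos])
  have hc0 : 0 < Real.cos (π / 5) := by rw [hc5]; positivity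
  have hcq : Real.cos (π / 5) ^ 2 = Real.cos (π / 5) / 2 + 1 / 4 := by
    rw [hc5]; linarith
  have h2 : 2 * π / 5 = 2 * (π / 5) := by ring
  have hsa : Real.sin (π / 5) * Real.cot (π / 5) = Real.cos (π / 5) := by
    rw [Real.cot_eq_cos_div_sin]; field_simp
  have hsb : Real.sin (π / 5) * Real.cot (2 * π / 5) = 1 - Real.cos (π / 5) := by
    rw [Real.cot_eq_cos_div_sin, h2, Real.sin_two_mul, Real.cos_two_mul]
    field_simp
    linarith
  have hsx : Real.sin (π / 5) * x = 1 / 2 := by rw [hx]; linarith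
  have hsy : Real.sin (π / 5) * y = Real.cos (π / 5) - 1 / 2 := by rw [hy]; linarith
  have hcπ : Real.arccos (Real.cos (π / 5)) = π / 5 :=
    Real.arccos_cos (by positivity) (by linarith [Real.pi_pos])
  generalize Real.cos (π / 5) = c at *
  generalize Real.sin (π / 5) = s at *
  have f0 : f.re = 0 := by rw [hf]
  have f1 : f.imI = x := by rw [hf]
  have f2 : f.imJ = y := by rw [hf]
  have f3 : f.imK = 0 := by rw [hf]
  have g0 : f'.re = 0 := by rw [hf']
  have g1 : f'.imI = 0 := by rw [hf']
  have g2 : f'.imJ = x := by rw [hf']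
  have g3 : f'.imK = y := by rw [hf']
  clear hf hf'
  have q0 : q.re = c := by rw [hq]; simp [f0]
  have q1 : q.imI = 1 / 2 := by rw [hq, ← hsx]; simp [f1]
  have q2 : q.imJ = c - 1 / 2 := by rw [hq, ← hsy]; simp [f2]
  have q3 : q.imK = 0 := by rw [hq]; simp [f3]
  have r0 : q'.re = c := by rw [hq']; simp [g0]
  have r1 : q'.imI = 0 := by rw [hq']; simp [g1]
  have r2 : q'.imJ = 1 / 2 := by rw [hq', ← hsx]; simp [g2]
  have r3 : q'.imK = c - 1 / 2 := by rw [hq', ← hsy]; simp [g3]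
  have hn : Quaternion.normSq q = 1 := by
    rw [Quaternion.normSq_def', q0, q1, q2, q3]; linarith
  constructor
  · have hinv : q⁻¹ = star q := by
      rw [Quaternion.inv_def, hn]; simp
    rw [hinv, Quaternion.re_mul]
    simp only [Quaternion.re_star, Quaternion.imI_star, Quaternion.imJ_star, Quaternion.imK_star,
      q0, q1, q2, q3, r0, r1, r2, r3]
    linarith
  · have : ⟪q, q'⟫ = c := by
      rw [Quaternion.inner_def, Quaternion.re_mul]
      simp only [Quaternion.re_star, Quaternion.imI_star, Quaternion.imJ_star,
        Quaternion.imK_star, q0, q1, q2, q3, r0, r1, r2, r3]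
      linarith
    rw [this, hcπ]
end

section
/- Let x = (cot(π/5) + cot(2π/5))/2 and y = (cot(π/5) − cot(2π/5))/2, let v = (i + j + k)/√3, and set f = x·i + y·j, f' = x·j + y·k, f'' = y·i + x·k. Let p = cos(π/3) + sin(π/3)•v. Then conjugation by p cyclically permutes f, f', f'': p·f·p⁻¹ = f', p·f'·p⁻¹ = f'', and p·f''·p⁻¹ = f. -/
open Quaternion Real

/-- With `x = (cot(π/5) + cot(2π/5))/2`, `y = (cot(π/5) − cot(2π/5))/2`,
`v = (i+j+k)/√3`, `f = x·i + y·j`, `f' = x·j + y·k`, `f'' = y·i + x·k`, and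
`p = cos(π/3) + sin(π/3)•v`, conjugation by `p` cyclically permutes `f, f', f''`. -/
theorem vertex_rotation_permutes_face_centers
    (x y : ℝ) (hx : x = (Real.cot (π / 5) + Real.cot (2 * π / 5)) / 2)
    (hy : y = (Real.cot (π / 5) - Real.cot (2 * π / 5)) / 2)
    (v f f' f'' p : ℍ[ℝ])
    (hv : v = (show ℍ[ℝ] from ⟨0, 1 / Real.sqrt 3, 1 / Real.sqrt 3, 1 / Real.sqrt 3⟩))
    (hf : f = (show ℍ[ℝ] from ⟨0, x, y, 0⟩))
    (hf' : f' = (show ℍ[ℝ] from ⟨0, 0, x, y⟩))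
    (hf'' : f'' = (show ℍ[ℝ] from ⟨0, y, 0, x⟩))
    (hp : p = (Real.cos (π / 3) : ℍ[ℝ]) + Real.sin (π / 3) • v) :
    p * f * p⁻¹ = f' ∧ p * f' * p⁻¹ = f'' ∧ p * f'' * p⁻¹ = f := by
  have h3 : Real.sqrt 3 ≠ 0 := by positivity
  have v0 : v.re = 0 := by rw [hv]
  have v1 : v.imI = 1 / Real.sqrt 3 := by rw [hv]
  have v2 : v.imJ = 1 / Real.sqrt 3 := by rw [hv]
  have v3 : v.imK = 1 / Real.sqrt 3 := by rw [hv]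
  have a0 : f.re = 0 := by rw [hf]
  have a1 : f.imI = x := by rw [hf]
  have a2 : f.imJ = y := by rw [hf]
  have a3 : f.imK = 0 := by rw [hf]
  have b0 : f'.re = 0 := by rw [hf']
  have b1 : f'.imI = 0 := by rw [hf']
  have b2 : f'.imJ = x := by rw [hf']
  have b3 : f'.imK = y := by rw [hf']
  have c0 : f''.re = 0 := by rw [hf'']
  have c1 : f''.imI = y := by rw [hf'']
  have c2 : f''.imJ = 0 := by rw [hf'']
  have c3 : f''.imK = x := by rw [hf'']
  rw [Real.cos_pi_div_three, Real.sin_pi_div_three] at hp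
  have p0 : p.re = 1 / 2 := by
    rw [hp, Quaternion.re_add, Quaternion.re_coe, Quaternion.re_smul, v0]; simp
  have p1 : p.imI = 1 / 2 := by
    rw [hp, Quaternion.imI_add, Quaternion.imI_coe, Quaternion.imI_smul, v1, smul_eq_mul]
    field_simp; norm_num
  have p2 : p.imJ = 1 / 2 := by
    rw [hp, Quaternion.imJ_add, Quaternion.imJ_coe, Quaternion.imJ_smul, v2, smul_eq_mul]
    field_simp; norm_num
  have p3 : p.imK = 1 / 2 := by
    rw [hp, Quaternion.imK_add, Quaternion.imK_coe, Quaternion.imK_smul, v3, smul_eq_mul]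
    field_simp; norm_num
  have hp0 : p ≠ 0 := by
    intro h
    rw [h, Quaternion.re_zero] at p0
    norm_num at p0
  clear hp hx hy hf hf' hf'' hv
  refine ⟨?_, ?_, ?_⟩ <;> rw [mul_inv_eq_iff_eq_mul₀ hp0] <;>
    ext <;> simp only [Quaternion.re_mul, Quaternion.imI_mul, Quaternion.imJ_mul,
      Quaternion.imK_mul, a0, a1, a2, a3, b0, b1, b2, b3, c0, c1, c2, c3, p0, p1, p2, p3] <;> ring
end

section
/- Let x = (cot(π/5) + cot(2π/5))/2 and y = (cot(π/5) − cot(2π/5))/2, set f = x·i + y·j, f' = x·j + y·k, f'' = y·i + x·k, and let q = cos(π/5) + sin(π/5)•f, q' = cos(π/5) + sin(π/5)•f', q'' = cos(π/5) + sin(π/5)•f''. Let s = 1 + q + q' + q''. Then s ≠ 0 and the real part of s/‖s‖ equals (1/2)·√(1 + 3·cos(π/5)). (Here s/‖s‖ is the spherical center of the regular spherical tetrahedron with vertices 1, q, q', q''.) -/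
open Quaternion Real

/-- With `x = (cot(π/5) + cot(2π/5))/2`, `y = (cot(π/5) − cot(2π/5))/2`,
`f = x·i + y·j`, `f' = x·j + y·k`, `f'' = y·i + x·k`, the lifted face rotations
`q = cos(π/5) + sin(π/5)•f` (and similarly `q'`, `q''`), and `s = 1 + q + q' + q''`:
`s ≠ 0` and the real part of `s/‖s‖` (the spherical center of the regular spherical
tetrahedron with vertices `1, q, q', q''`) equals `(1/2)·√(1 + 3·cos(π/5))`. -/
theorem spherical_center_real_part
    (x y : ℝ) (hx : x = (Real.cot (π / 5) + Real.cot (2 * π / 5)) / 2)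
    (hy : y = (Real.cot (π / 5) - Real.cot (2 * π / 5)) / 2)
    (f f' f'' q q' q'' s : ℍ[ℝ])
    (hf : f = (show ℍ[ℝ] from ⟨0, x, y, 0⟩))
    (hf' : f' = (show ℍ[ℝ] from ⟨0, 0, x, y⟩))
    (hf'' : f'' = (show ℍ[ℝ] from ⟨0, y, 0, x⟩))
    (hq : q = (Real.cos (π / 5) : ℍ[ℝ]) + Real.sin (π / 5) • f)
    (hq' : q' = (Real.cos (π / 5) : ℍ[ℝ]) + Real.sin (π / 5) • f')
    (hq'' : q'' = (Real.cos (π / 5) : ℍ[ℝ]) + Real.sin (π / 5) • f'')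
    (hs : s = 1 + q + q' + q'') :
    s ≠ 0 ∧ (‖s‖⁻¹ • s).re = (1 / 2) * Real.sqrt (1 + 3 * Real.cos (π / 5)) := by
  have hS : 0 < Real.sin (π / 5) :=
    Real.sin_pos_of_pos_of_lt_pi (by positivity) (by linarith [Real.pi_pos])
  have hc : 0 < Real.cos (π / 5) :=
    Real.cos_pos_of_mem_Ioo ⟨by linarith [Real.pi_pos], by linarith [Real.pi_pos]⟩
  have hc2 : 4 * Real.cos (π / 5) ^ 2 - 2 * Real.cos (π / 5) - 1 = 0 := by
    rw [Real.cos_pi_div_five]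
    have h5 : Real.sqrt 5 ^ 2 = 5 := Real.sq_sqrt (by norm_num)
    linear_combination (1 / 4) * h5
  have hxy : Real.sin (π / 5) * x + Real.sin (π / 5) * y = Real.cos (π / 5) := by
    have : x + y = Real.cot (π / 5) := by rw [hx, hy]; ring
    rw [← mul_add, this, Real.cot_eq_cos_div_sin]
    field_simp
  clear hx hy
  generalize Real.cos (π / 5) = c at *
  generalize Real.sin (π / 5) = S at *
  have hfre : f.re = 0 := by rw [hf]
  have hfimI : f.imI = x := by rw [hf]
  have hfimJ : f.imJ = y := by rw [hf]
  have hfimK : f.imK = 0 := by rw [hf]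
  have hfpre : f'.re = 0 := by rw [hf']
  have hfpimI : f'.imI = 0 := by rw [hf']
  have hfpimJ : f'.imJ = x := by rw [hf']
  have hfpimK : f'.imK = y := by rw [hf']
  have hfppre : f''.re = 0 := by rw [hf'']
  have hfppimI : f''.imI = y := by rw [hf'']
  have hfppimJ : f''.imJ = 0 := by rw [hf'']
  have hfppimK : f''.imK = x := by rw [hf'']
  clear hf hf' hf''
  have hre : s.re = 1 + 3 * c := by
    subst hs hq hq' hq''; simp [hfre, hfimI, hfimJ, hfimK, hfpre, hfpimI, hfpimJ, hfpimK, hfppre, hfppimI, hfppimJ, hfppimK]; ring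
  have hi : s.imI = c := by
    subst hs hq hq' hq''; simp [hfre, hfimI, hfimJ, hfimK, hfpre, hfpimI, hfpimJ, hfpimK, hfppre, hfppimI, hfppimJ, hfppimK]; linarith
  have hj : s.imJ = c := by
    subst hs hq hq' hq''; simp [hfre, hfimI, hfimJ, hfimK, hfpre, hfpimI, hfpimJ, hfpimK, hfppre, hfppimI, hfppimJ, hfppimK]; linarith
  have hk : s.imK = c := by
    subst hs hq hq' hq''; simp [hfre, hfimI, hfimJ, hfimK, hfpre, hfpimI, hfpimJ, hfpimK, hfppre, hfppimI, hfppimJ, hfppimK]; linarith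
  have hp : 0 < 1 + 3 * c := by linarith
  have hn : ‖s‖ ^ 2 = 4 * (1 + 3 * c) := by
    rw [sq, ← Quaternion.normSq_eq_norm_mul_self, Quaternion.normSq_def', hre, hi, hj, hk]
    linear_combination 3 * hc2
  have hn' : ‖s‖ = 2 * Real.sqrt (1 + 3 * c) := by
    rw [← Real.sqrt_sq (norm_nonneg s), hn, Real.sqrt_mul (by norm_num)]
    congr 1
    rw [show (4 : ℝ) = 2 ^ 2 by norm_num, Real.sqrt_sq (by norm_num)]
  refine ⟨fun h => ?_, ?_⟩
  · rw [h] at hre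
    simp at hre
    linarith
  · have hq0 : 0 < Real.sqrt (1 + 3 * c) := Real.sqrt_pos.mpr hp
    have hqq : Real.sqrt (1 + 3 * c) ^ 2 = 1 + 3 * c := Real.sq_sqrt hp.le
    rw [Quaternion.re_smul, hre, hn', smul_eq_mul]
    generalize Real.sqrt (1 + 3 * c) = r at *
    rw [← hqq]
    field_simp
end
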